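/- arXiv:1809.01595 — 2 statements merged into one kernel-verified Lean document; each statement's English description precedes it below -/
import Mathlib

section
/- For every l ∈ ℕ, the second derivative of P_l ∘ h along V in the y-variables applied twice, evaluated on the diagonal, satisfies V_y V_y P_l(h)|_{x=y} = −‖V‖²(θ, φ) P_l'(1), where ‖V‖²(θ, φ) = sin²(φ) v₁(θ, φ)² + v₂(θ, φ)². -/
open Real

/-- The degree-`l` Legendre polynomial, via the Rodrigues formula
`P_l(t) = 1/(2^l l!) dˡ/dtˡ (t² − 1)ˡ`. -/
noncomputable def legP (l : ℕ) : ℝ → ℝ :=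
  fun t => (1 / (2 ^ l * (Nat.factorial l : ℝ))) * iteratedDeriv l (fun s => (s ^ 2 - 1) ^ l) t

/-- `h(θ_x, φ_x, θ_y, φ_y)`, the cosine of the spherical distance. -/
noncomputable def sphH (θx φx θy φy : ℝ) : ℝ :=
  Real.cos φx * Real.cos φy + Real.sin φx * Real.sin φy * Real.cos (θx - θy)

/-- Functions of the four variables `(θ_x, φ_x, θ_y, φ_y)`. -/
abbrev F4 : Type := ℝ → ℝ → ℝ → ℝ → ℝ

/-- `∂/∂θ_x`. -/
noncomputable def pθx (f : F4) : F4 := fun a b c d => deriv (fun t => f t b c d) a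
/-- `∂/∂φ_x`. -/
noncomputable def pφx (f : F4) : F4 := fun a b c d => deriv (fun t => f a t c d) b
/-- `∂/∂θ_y`. -/
noncomputable def pθy (f : F4) : F4 := fun a b c d => deriv (fun t => f a b t d) c
/-- `∂/∂φ_y`. -/
noncomputable def pφy (f : F4) : F4 := fun a b c d => deriv (fun t => f a b c t) d

/-- The operator `V_x = v₁(θ_x,φ_x) ∂/∂θ_x + v₂(θ_x,φ_x) ∂/∂φ_x`. -/
noncomputable def Vx (v₁ v₂ : ℝ → ℝ → ℝ) (f : F4) : F4 :=
  fun a b c d => v₁ a b * pθx f a b c d + v₂ a b * pφx f a b c d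

/-- The operator `V_y = v₁(θ_y,φ_y) ∂/∂θ_y + v₂(θ_y,φ_y) ∂/∂φ_y`. -/
noncomputable def Vy (v₁ v₂ : ℝ → ℝ → ℝ) (f : F4) : F4 :=
  fun a b c d => v₁ c d * pθy f a b c d + v₂ c d * pφy f a b c d

/-- The operator `V_x^⊥ = v₂(θ_x,φ_x) ∂/∂θ_x − sin²(φ_x) v₁(θ_x,φ_x) ∂/∂φ_x`. -/
noncomputable def Vxp (v₁ v₂ : ℝ → ℝ → ℝ) (f : F4) : F4 :=
  fun a b c d => v₂ a b * pθx f a b c d - (Real.sin b) ^ 2 * v₁ a b * pφx f a b c d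

/-- The operator `V_y^⊥ = v₂(θ_y,φ_y) ∂/∂θ_y − sin²(φ_y) v₁(θ_y,φ_y) ∂/∂φ_y`. -/
noncomputable def Vyp (v₁ v₂ : ℝ → ℝ → ℝ) (f : F4) : F4 :=
  fun a b c d => v₂ c d * pθy f a b c d - (Real.sin d) ^ 2 * v₁ c d * pφy f a b c d

/-- `P_l ∘ h` as a function of the four variables. -/
noncomputable def PH (l : ℕ) : F4 := fun a b c d => legP l (sphH a b c d)

theorem contDiff_legP (l : ℕ) : ContDiff ℝ (⊤ : ℕ∞) (legP l) := by
  unfold legP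
  refine contDiff_const.mul ?_
  have h : ContDiff ℝ (⊤ : ℕ∞) (fun s : ℝ => (s ^ 2 - 1) ^ l) := by fun_prop
  rw [iteratedDeriv_eq_iterate]
  exact h.iterate_deriv l

theorem hasDerivAt_sphH_θy (a b c d : ℝ) :
    HasDerivAt (fun t => sphH a b t d) (sin b * sin d * sin (a - c)) c := by
  have h := ((((hasDerivAt_id c).const_sub a).cos.const_mul (sin b * sin d)).const_add
    (cos b * cos d))
  exact h.congr_deriv (by simp)

theorem hasDerivAt_sphH_φy (a b c d : ℝ) :
    HasDerivAt (fun t => sphH a b c t) (-(cos b * sin d) + sin b * cos d * cos (a - c)) d := by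
  have h := ((hasDerivAt_cos d).const_mul (cos b)).add
    (((hasDerivAt_sin d).const_mul (sin b)).mul_const (cos (a - c)))
  exact h.congr_deriv (by ring)

theorem sphH_diag (θ φ : ℝ) : sphH θ φ θ φ = 1 := by
  have h := sin_sq_add_cos_sq φ
  simp only [sphH, sub_self, cos_zero]
  linarith

/-- The chain rule for `V_y` applied to `P_l ∘ h`. -/
theorem Vy_PH (v₁ v₂ : ℝ → ℝ → ℝ) (l : ℕ) (a b c d : ℝ) :
    Vy v₁ v₂ (PH l) a b c d = deriv (legP l) (sphH a b c d) *
      (v₁ c d * (sin b * sin d * sin (a - c)) +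
        v₂ c d * (-(cos b * sin d) + sin b * cos d * cos (a - c))) := by
  have hP : HasDerivAt (legP l) (deriv (legP l) (sphH a b c d)) (sphH a b c d) :=
    ((contDiff_legP l).differentiable (by simp) _).hasDerivAt
  have hθ : pθy (PH l) a b c d = _ := (hP.comp c (hasDerivAt_sphH_θy a b c d)).deriv
  have hφ : pφy (PH l) a b c d = _ := (hP.comp d (hasDerivAt_sphH_φy a b c d)).deriv
  rw [Vy, hθ, hφ]
  ring

/-- `V_y V_y P_l(h)` on the diagonal equals `−‖V‖² P_l'(1)`. -/
theorem VyVy_on_diagonal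
    (v₁ v₂ : ℝ → ℝ → ℝ)
    (hv₁ : ContDiff ℝ (⊤ : ℕ∞) (Function.uncurry v₁)) (hv₂ : ContDiff ℝ (⊤ : ℕ∞) (Function.uncurry v₂))
    (l : ℕ) (θ φ : ℝ) (hφ : φ ∈ Set.Ioo 0 π) :
    Vy v₁ v₂ (Vy v₁ v₂ (PH l)) θ φ θ φ =
      -(((Real.sin φ) ^ 2 * (v₁ θ φ) ^ 2 + (v₂ θ φ) ^ 2) * deriv (legP l) 1) := by
  have hP : HasDerivAt (deriv (legP l)) (deriv (deriv (legP l)) (sphH θ φ θ φ))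
      (sphH θ φ θ φ) :=
    (((contDiff_legP l).iterate_deriv 1).differentiable (by simp) _).hasDerivAt
  have hsec_θ : ∀ {v : ℝ → ℝ → ℝ}, ContDiff ℝ (⊤ : ℕ∞) (Function.uncurry v) →
      HasDerivAt (fun t => v t φ) (deriv (fun t => v t φ) θ) θ := fun {v} hv =>
    ((hv.differentiable (by simp)).comp (f := fun t : ℝ => (t, φ)) (by fun_prop) θ).hasDerivAt
  have hsec_φ : ∀ {v : ℝ → ℝ → ℝ}, ContDiff ℝ (⊤ : ℕ∞) (Function.uncurry v) →
      HasDerivAt (fun t => v θ t) (deriv (fun t => v θ t) φ) φ := fun {v} hv =>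
    ((hv.differentiable (by simp)).comp (f := fun t : ℝ => (θ, t)) (by fun_prop) φ).hasDerivAt
  have hsub := (hasDerivAt_id θ).const_sub θ
  have hθ := (hP.comp θ (hasDerivAt_sphH_θy θ φ θ φ)).mul
    (((hsec_θ hv₁).mul (hsub.sin.const_mul (sin φ * sin φ))).add
      ((hsec_θ hv₂).mul ((hsub.cos.const_mul (sin φ * cos φ)).const_add (-(cos φ * sin φ)))))
  have hφ' := (hP.comp φ (hasDerivAt_sphH_φy θ φ θ φ)).mul
    (((hsec_φ hv₁).mul (((hasDerivAt_sin φ).const_mul (sin φ)).mul_const (sin (θ - θ)))).add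
      ((hsec_φ hv₂).mul ((((hasDerivAt_sin φ).const_mul (cos φ)).neg).add
        (((hasDerivAt_cos φ).const_mul (sin φ)).mul_const (cos (θ - θ))))))
  have eθ : pθy (Vy v₁ v₂ (PH l)) θ φ θ φ = _ :=
    (hθ.congr_of_eventuallyEq (.of_forall fun t => Vy_PH v₁ v₂ l θ φ t φ)).deriv
  have eφ : pφy (Vy v₁ v₂ (PH l)) θ φ θ φ = _ :=
    (hφ'.congr_of_eventuallyEq (.of_forall fun t => Vy_PH v₁ v₂ l θ φ θ t)).deriv
  rw [Vy, eθ, eφ]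
  simp [sphH_diag]
  linear_combination (-(v₂ θ φ) ^ 2 * deriv (legP l) 1) * sin_sq_add_cos_sq φ
end

section
/- There is a function c(θ, φ), given by an explicit polynomial expression in v₁, v₂, their first partial derivatives, sin φ and cos φ (independent of l), such that for every l ∈ ℕ the fourth mixed derivative of P_l ∘ h along V twice in the x-variables and twice in the y-variables, evaluated on the diagonal, satisfies V_x V_x V_y V_y P_l(h)|_{x=y} = 3 ‖V‖⁴(θ, φ) P_l''(1) + c(θ, φ) P_l'(1). In particular, V_x V_x V_y V_y P_l(h)|_{x=y} = (3/8) ‖V‖⁴(θ, φ) l⁴ + (3/4) ‖V‖⁴(θ, φ) l³ + O_V(l²), with the remainder bounded uniformly in (θ, φ) by a constant depending only on v₁, v₂ and their first derivatives. -/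
open Real

/-- `‖V‖²(θ,φ) = sin²(φ) v₁(θ,φ)² + v₂(θ,φ)²`. -/
noncomputable def nV2 (v₁ v₂ : ℝ → ℝ → ℝ) (θ φ : ℝ) : ℝ :=
  (Real.sin φ) ^ 2 * (v₁ θ φ) ^ 2 + (v₂ θ φ) ^ 2

open Polynomial in
/-- The Legendre polynomial `legP l` as an element of `ℝ[X]`. -/
noncomputable def legendrePoly (l : ℕ) : ℝ[X] :=
  C (1 / (2 ^ l * (Nat.factorial l : ℝ))) * derivative^[l] ((X ^ 2 - 1) ^ l)

lemma iteratedDeriv_polynomial_eval (n : ℕ) (p : Polynomial ℝ) :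
    iteratedDeriv n (fun x => p.eval x) = fun x => (Polynomial.derivative^[n] p).eval x := by
  induction n with
  | zero => simp
  | succ n ih =>
    rw [iteratedDeriv_succ, ih, Function.iterate_succ_apply']
    funext x
    exact Polynomial.deriv _

lemma legP_eq_eval (l : ℕ) : legP l = fun t => (legendrePoly l).eval t := by
  have h := iteratedDeriv_polynomial_eval l ((Polynomial.X ^ 2 - 1) ^ l)
  simp only [Polynomial.eval_pow, Polynomial.eval_sub, Polynomial.eval_X,
    Polynomial.eval_one] at h
  funext t
  simp [legP, legendrePoly, h]

open Polynomial in
lemma eval_one_iterate_derivative_sq_sub_one_pow (l k : ℕ) :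
    (derivative^[l + k] ((X ^ 2 - 1 : ℝ[X]) ^ l)).eval 1 =
      (l + k).factorial * (2 ^ (l - k) * l.choose k) := by
  have h := congrArg (fun f => (f ((X ^ 2 - 1 : ℝ[X]) ^ l)).eval 1)
    (Polynomial.factorial_smul_hasseDeriv (R := ℝ) (l + k))
  have hf : taylor 1 ((X ^ 2 - 1 : ℝ[X]) ^ l) = X ^ l * (X + C 2) ^ l := by
    rw [taylor_pow, ← mul_pow]
    congr 1
    simp only [map_sub, taylor_pow, taylor_X, taylor_one, map_one]
    rw [show (C 2 : ℝ[X]) = 2 from rfl]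
    ring
  simp only [LinearMap.smul_apply, eval_smul] at h
  rw [← h, nsmul_eq_mul, ← taylor_coeff, hf, add_comm l k, coeff_X_pow_mul, coeff_X_add_C_pow]

open Polynomial in
lemma eval_one_derivative_legendrePoly (l : ℕ) :
    (derivative (legendrePoly l)).eval 1 = (l : ℝ) * (l + 1) / 2 := by
  have h := eval_one_iterate_derivative_sq_sub_one_pow l 1
  rw [legendrePoly, derivative_C_mul, eval_C_mul, ← Function.iterate_succ_apply' derivative, h]
  rcases l with _ | m
  · simp
  · simp only [Nat.factorial_succ, Nat.add_sub_cancel, Nat.choose_one_right]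
    have hm : (m.factorial : ℝ) ≠ 0 := by exact_mod_cast Nat.factorial_ne_zero m
    push_cast
    field_simp
    ring

open Polynomial in
lemma eval_one_derivative_derivative_legendrePoly (l : ℕ) :
    (derivative (derivative (legendrePoly l))).eval 1 =
      ((l : ℝ) - 1) * l * (l + 1) * (l + 2) / 8 := by
  have h := eval_one_iterate_derivative_sq_sub_one_pow l 2
  rw [legendrePoly, derivative_C_mul, derivative_C_mul, eval_C_mul,
    ← Function.iterate_succ_apply' derivative, ← Function.iterate_succ_apply' derivative, h]
  rcases l with _ | _ | m
  · simp
  · simp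
  · simp only [Nat.factorial_succ]
    have hm : (m.factorial : ℝ) ≠ 0 := by exact_mod_cast Nat.factorial_ne_zero m
    rw [Nat.cast_choose_two]
    push_cast
    field_simp
    ring

/-- Smoothness of a function of four real variables, jointly in all of them. -/
def Smooth4 (f : F4) : Prop :=
  ContDiff ℝ (⊤ : ℕ∞) (fun p : ℝ × ℝ × ℝ × ℝ => f p.1 p.2.1 p.2.2.1 p.2.2.2)

namespace Smooth4

variable {f g : F4}

lemma add (hf : Smooth4 f) (hg : Smooth4 g) : Smooth4 (f + g) := ContDiff.add hf hg

lemma mul (hf : Smooth4 f) (hg : Smooth4 g) : Smooth4 (f * g) := ContDiff.mul hf hg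

lemma differentiableAt (hf : Smooth4 f) (p : ℝ × ℝ × ℝ × ℝ) :
    DifferentiableAt ℝ (fun p : ℝ × ℝ × ℝ × ℝ => f p.1 p.2.1 p.2.2.1 p.2.2.2) p :=
  ContDiff.differentiable hf (by simp) p

lemma hasDerivAt_θx (hf : Smooth4 f) (a b c d : ℝ) :
    HasDerivAt (fun t => f t b c d) (pθx f a b c d) a :=
  DifferentiableAt.hasDerivAt ((hf.differentiableAt (a, b, c, d)).comp a
    (f := fun t : ℝ => (t, b, c, d)) (by fun_prop))

lemma hasDerivAt_φx (hf : Smooth4 f) (a b c d : ℝ) :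
    HasDerivAt (fun t => f a t c d) (pφx f a b c d) b :=
  DifferentiableAt.hasDerivAt ((hf.differentiableAt (a, b, c, d)).comp b
    (f := fun t : ℝ => (a, t, c, d)) (by fun_prop))

lemma hasDerivAt_θy (hf : Smooth4 f) (a b c d : ℝ) :
    HasDerivAt (fun t => f a b t d) (pθy f a b c d) c :=
  DifferentiableAt.hasDerivAt ((hf.differentiableAt (a, b, c, d)).comp c
    (f := fun t : ℝ => (a, b, t, d)) (by fun_prop))

lemma hasDerivAt_φy (hf : Smooth4 f) (a b c d : ℝ) :
    HasDerivAt (fun t => f a b c t) (pφy f a b c d) d :=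
  DifferentiableAt.hasDerivAt ((hf.differentiableAt (a, b, c, d)).comp d
    (f := fun t : ℝ => (a, b, c, t)) (by fun_prop))

lemma fderiv_apply (hf : Smooth4 f) (e : ℝ × ℝ × ℝ × ℝ) :
    ContDiff ℝ (⊤ : ℕ∞) (fun p => fderiv ℝ
      (fun p : ℝ × ℝ × ℝ × ℝ => f p.1 p.2.1 p.2.2.1 p.2.2.2) p e) :=
  (ContDiff.fderiv_right hf (m := (⊤ : ℕ∞)) (by simp)).clm_apply contDiff_const

lemma pθx (hf : Smooth4 f) : Smooth4 (pθx f) := by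
  refine (congrArg (ContDiff ℝ (⊤ : ℕ∞)) (funext fun p => ?_)).mpr (hf.fderiv_apply (1, 0, 0, 0))
  have h : HasDerivAt (fun t : ℝ => (t, p.2.1, p.2.2.1, p.2.2.2)) (1, 0, 0, 0) p.1 :=
    (hasDerivAt_id _).prodMk ((hasDerivAt_const _ _).prodMk
      ((hasDerivAt_const _ _).prodMk (hasDerivAt_const _ _)))
  exact ((hf.differentiableAt p).hasFDerivAt.comp_hasDerivAt p.1 h).deriv

lemma pφx (hf : Smooth4 f) : Smooth4 (pφx f) := by
  refine (congrArg (ContDiff ℝ (⊤ : ℕ∞)) (funext fun p => ?_)).mpr (hf.fderiv_apply (0, 1, 0, 0))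
  have h : HasDerivAt (fun t : ℝ => (p.1, t, p.2.2.1, p.2.2.2)) (0, 1, 0, 0) p.2.1 :=
    (hasDerivAt_const _ _).prodMk ((hasDerivAt_id _).prodMk
      ((hasDerivAt_const _ _).prodMk (hasDerivAt_const _ _)))
  exact ((hf.differentiableAt p).hasFDerivAt.comp_hasDerivAt p.2.1 h).deriv

lemma pθy (hf : Smooth4 f) : Smooth4 (pθy f) := by
  refine (congrArg (ContDiff ℝ (⊤ : ℕ∞)) (funext fun p => ?_)).mpr (hf.fderiv_apply (0, 0, 1, 0))
  have h : HasDerivAt (fun t : ℝ => (p.1, p.2.1, t, p.2.2.2)) (0, 0, 1, 0) p.2.2.1 :=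
    (hasDerivAt_const _ _).prodMk ((hasDerivAt_const _ _).prodMk
      ((hasDerivAt_id _).prodMk (hasDerivAt_const _ _)))
  exact ((hf.differentiableAt p).hasFDerivAt.comp_hasDerivAt p.2.2.1 h).deriv

lemma pφy (hf : Smooth4 f) : Smooth4 (pφy f) := by
  refine (congrArg (ContDiff ℝ (⊤ : ℕ∞)) (funext fun p => ?_)).mpr (hf.fderiv_apply (0, 0, 0, 1))
  have h : HasDerivAt (fun t : ℝ => (p.1, p.2.1, p.2.2.1, t)) (0, 0, 0, 1) p.2.2.2 :=
    (hasDerivAt_const _ _).prodMk ((hasDerivAt_const _ _).prodMk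
      ((hasDerivAt_const _ _).prodMk (hasDerivAt_id _)))
  exact ((hf.differentiableAt p).hasFDerivAt.comp_hasDerivAt p.2.2.2 h).deriv

lemma fun_x {v : ℝ → ℝ → ℝ} (hv : ContDiff ℝ (⊤ : ℕ∞) (Function.uncurry v)) :
    Smooth4 (fun a b _ _ => v a b) :=
  hv.comp (f := fun p : ℝ × ℝ × ℝ × ℝ => (p.1, p.2.1)) (by fun_prop)

lemma fun_y {v : ℝ → ℝ → ℝ} (hv : ContDiff ℝ (⊤ : ℕ∞) (Function.uncurry v)) :
    Smooth4 (fun _ _ c d => v c d) :=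
  hv.comp (f := fun p : ℝ × ℝ × ℝ × ℝ => (p.2.2.1, p.2.2.2)) (by fun_prop)

lemma polynomial_comp (hf : Smooth4 f) (q : Polynomial ℝ) :
    Smooth4 (fun a b c d => q.eval (f a b c d)) :=
  (show ContDiff ℝ (⊤ : ℕ∞) fun x : ℝ => q.eval x from q.contDiff_aeval _).comp hf

end Smooth4

section VectorField

variable {v₁ v₂ : ℝ → ℝ → ℝ} {f g : F4}

lemma Smooth4.Vx (hv₁ : ContDiff ℝ (⊤ : ℕ∞) (Function.uncurry v₁))
    (hv₂ : ContDiff ℝ (⊤ : ℕ∞) (Function.uncurry v₂)) (hf : Smooth4 f) :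
    Smooth4 (Vx v₁ v₂ f) :=
  ((Smooth4.fun_x hv₁).mul hf.pθx).add ((Smooth4.fun_x hv₂).mul hf.pφx)

lemma Smooth4.Vy (hv₁ : ContDiff ℝ (⊤ : ℕ∞) (Function.uncurry v₁))
    (hv₂ : ContDiff ℝ (⊤ : ℕ∞) (Function.uncurry v₂)) (hf : Smooth4 f) :
    Smooth4 (Vy v₁ v₂ f) :=
  ((Smooth4.fun_y hv₁).mul hf.pθy).add ((Smooth4.fun_y hv₂).mul hf.pφy)

lemma Vx_add (hf : Smooth4 f) (hg : Smooth4 g) :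
    Vx v₁ v₂ (f + g) = Vx v₁ v₂ f + Vx v₁ v₂ g := by
  funext a b c d
  have h₁ : pθx (f + g) a b c d = _ :=
    ((hf.hasDerivAt_θx a b c d).add (hg.hasDerivAt_θx a b c d)).deriv
  have h₂ : pφx (f + g) a b c d = _ :=
    ((hf.hasDerivAt_φx a b c d).add (hg.hasDerivAt_φx a b c d)).deriv
  simp only [Vx, h₁, h₂, Pi.add_apply]
  ring

lemma Vy_add (hf : Smooth4 f) (hg : Smooth4 g) :
    Vy v₁ v₂ (f + g) = Vy v₁ v₂ f + Vy v₁ v₂ g := by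
  funext a b c d
  have h₁ : pθy (f + g) a b c d = _ :=
    ((hf.hasDerivAt_θy a b c d).add (hg.hasDerivAt_θy a b c d)).deriv
  have h₂ : pφy (f + g) a b c d = _ :=
    ((hf.hasDerivAt_φy a b c d).add (hg.hasDerivAt_φy a b c d)).deriv
  simp only [Vy, h₁, h₂, Pi.add_apply]
  ring

lemma Vx_mul (hf : Smooth4 f) (hg : Smooth4 g) :
    Vx v₁ v₂ (f * g) = Vx v₁ v₂ f * g + f * Vx v₁ v₂ g := by
  funext a b c d
  have h₁ : pθx (f * g) a b c d = _ :=
    ((hf.hasDerivAt_θx a b c d).mul (hg.hasDerivAt_θx a b c d)).deriv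
  have h₂ : pφx (f * g) a b c d = _ :=
    ((hf.hasDerivAt_φx a b c d).mul (hg.hasDerivAt_φx a b c d)).deriv
  simp only [Vx, h₁, h₂, Pi.add_apply, Pi.mul_apply]
  ring

lemma Vy_mul (hf : Smooth4 f) (hg : Smooth4 g) :
    Vy v₁ v₂ (f * g) = Vy v₁ v₂ f * g + f * Vy v₁ v₂ g := by
  funext a b c d
  have h₁ : pθy (f * g) a b c d = _ :=
    ((hf.hasDerivAt_θy a b c d).mul (hg.hasDerivAt_θy a b c d)).deriv
  have h₂ : pφy (f * g) a b c d = _ :=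
    ((hf.hasDerivAt_φy a b c d).mul (hg.hasDerivAt_φy a b c d)).deriv
  simp only [Vy, h₁, h₂, Pi.add_apply, Pi.mul_apply]
  ring

lemma Vx_polynomial_comp (hf : Smooth4 f) (q : Polynomial ℝ) :
    Vx v₁ v₂ (fun a b c d => q.eval (f a b c d)) =
      (fun a b c d => q.derivative.eval (f a b c d)) * Vx v₁ v₂ f := by
  funext a b c d
  have h₁ : pθx (fun a b c d => q.eval (f a b c d)) a b c d = _ :=
    ((q.hasDerivAt _).comp a (hf.hasDerivAt_θx a b c d)).deriv
  have h₂ : pφx (fun a b c d => q.eval (f a b c d)) a b c d = _ :=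
    ((q.hasDerivAt _).comp b (hf.hasDerivAt_φx a b c d)).deriv
  simp only [Vx, h₁, h₂, Pi.mul_apply]
  ring

lemma Vy_polynomial_comp (hf : Smooth4 f) (q : Polynomial ℝ) :
    Vy v₁ v₂ (fun a b c d => q.eval (f a b c d)) =
      (fun a b c d => q.derivative.eval (f a b c d)) * Vy v₁ v₂ f := by
  funext a b c d
  have h₁ : pθy (fun a b c d => q.eval (f a b c d)) a b c d = _ :=
    ((q.hasDerivAt _).comp c (hf.hasDerivAt_θy a b c d)).deriv
  have h₂ : pφy (fun a b c d => q.eval (f a b c d)) a b c d = _ :=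
    ((q.hasDerivAt _).comp d (hf.hasDerivAt_φy a b c d)).deriv
  simp only [Vy, h₁, h₂, Pi.mul_apply]
  ring

/-- At a point where `V_x f` and `V_y f` vanish, only second and first derivatives of the outer
function survive. -/
lemma VxVxVyVy_polynomial_comp (hv₁ : ContDiff ℝ (⊤ : ℕ∞) (Function.uncurry v₁))
    (hv₂ : ContDiff ℝ (⊤ : ℕ∞) (Function.uncurry v₂)) (hf : Smooth4 f) (q : Polynomial ℝ)
    {a b c d : ℝ} (hx : Vx v₁ v₂ f a b c d = 0) (hy : Vy v₁ v₂ f a b c d = 0) :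
    Vx v₁ v₂ (Vx v₁ v₂ (Vy v₁ v₂ (Vy v₁ v₂ fun a b c d => q.eval (f a b c d)))) a b c d =
      q.derivative.derivative.eval (f a b c d) *
          (2 * (Vx v₁ v₂ (Vy v₁ v₂ f) a b c d) ^ 2 +
            Vx v₁ v₂ (Vx v₁ v₂ f) a b c d * Vy v₁ v₂ (Vy v₁ v₂ f) a b c d) +
        q.derivative.eval (f a b c d) *
          Vx v₁ v₂ (Vx v₁ v₂ (Vy v₁ v₂ (Vy v₁ v₂ f))) a b c d := by
  have hX {g : F4} (hg : Smooth4 g) : Smooth4 (Vx v₁ v₂ g) := hg.Vx hv₁ hv₂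
  have hY {g : F4} (hg : Smooth4 g) : Smooth4 (Vy v₁ v₂ g) := hg.Vy hv₁ hv₂
  have hQ (q : Polynomial ℝ) := hf.polynomial_comp q
  have hA {g k : F4} (hg : Smooth4 g) (hk : Smooth4 k) : Smooth4 (g + k) := hg.add hk
  have hM {g k : F4} (hg : Smooth4 g) (hk : Smooth4 k) : Smooth4 (g * k) := hg.mul hk
  simp (maxDischargeDepth := 12) only [Vy_polynomial_comp, Vx_polynomial_comp, Vx_add,
    Vx_mul, Vy_mul, hX, hY, hQ, hA, hM, hf]
  simp only [Pi.add_apply, Pi.mul_apply, hx, hy]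
  ring

end VectorField

lemma smooth4_sphH : Smooth4 sphH := by
  unfold Smooth4 sphH
  fun_prop

lemma pθx_sphH : pθx sphH = fun a b c d => -(sin b * sin d * sin (a - c)) := by
  funext a b c d
  have h : HasDerivAt (fun t => sphH t b c d) (-(sin b * sin d * sin (a - c))) a := by
    have := (((hasDerivAt_id a).sub_const c).cos.const_mul (sin b * sin d)).const_add
      (cos b * cos d)
    exact this.congr_deriv (by simp)
  exact h.deriv

lemma pφx_sphH :
    pφx sphH = fun a b c d => -(sin b * cos d) + cos b * sin d * cos (a - c) := by
  funext a b c d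
  have h := ((hasDerivAt_cos b).mul_const (cos d)).add
    (((hasDerivAt_sin b).mul_const (sin d)).mul_const (cos (a - c)))
  rw [← neg_mul]
  exact h.deriv

lemma pθy_sphH : pθy sphH = fun a b c d => sin b * sin d * sin (a - c) := by
  funext a b c d
  have h : HasDerivAt (fun t => sphH a b t d) (sin b * sin d * sin (a - c)) c := by
    have := (((hasDerivAt_id c).const_sub a).cos.const_mul (sin b * sin d)).const_add
      (cos b * cos d)
    exact this.congr_deriv (by simp)
  exact h.deriv

lemma pφy_sphH :
    pφy sphH = fun a b c d => -(cos b * sin d) + sin b * cos d * cos (a - c) := by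
  funext a b c d
  have h := ((hasDerivAt_cos d).const_mul (cos b)).add
    (((hasDerivAt_sin d).const_mul (sin b)).mul_const (cos (a - c)))
  rw [← mul_neg]
  exact h.deriv

section Diagonal

variable (v₁ v₂ : ℝ → ℝ → ℝ) (θ φ : ℝ)

lemma sphH_diagonal : sphH θ φ θ φ = 1 := by
  simp only [sphH, sub_self, cos_zero]
  nlinarith [sin_sq_add_cos_sq φ]

lemma Vx_sphH_diagonal : Vx v₁ v₂ sphH θ φ θ φ = 0 := by
  simp only [Vx, pθx_sphH, pφx_sphH, sub_self, cos_zero, sin_zero]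
  ring

lemma Vy_sphH_diagonal : Vy v₁ v₂ sphH θ φ θ φ = 0 := by
  simp only [Vy, pθy_sphH, pφy_sphH, sub_self, cos_zero, sin_zero]
  ring

variable {v₁ v₂}

lemma VxVx_sphH_diagonal (hv₁ : ContDiff ℝ (⊤ : ℕ∞) (Function.uncurry v₁))
    (hv₂ : ContDiff ℝ (⊤ : ℕ∞) (Function.uncurry v₂)) :
    Vx v₁ v₂ (Vx v₁ v₂ sphH) θ φ θ φ = -nV2 v₁ v₂ θ φ := by
  have h : Vx v₁ v₂ sphH =
    (fun a b _ _ => v₁ a b) * pθx sphH + (fun a b _ _ => v₂ a b) * pφx sphH := rfl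
  have h₁ := Smooth4.fun_x hv₁
  have h₂ := Smooth4.fun_x hv₂
  have hθ := smooth4_sphH.pθx
  have hφ := smooth4_sphH.pφx
  rw [h, Vx_add (h₁.mul hθ) (h₂.mul hφ), Vx_mul h₁ hθ, Vx_mul h₂ hφ, pθx_sphH, pφx_sphH]
  simp [Vx, pθx, pφx, nV2, deriv_comp_sub_const (f := sin), deriv_comp_sub_const (f := cos)]
  linear_combination (-(v₂ θ φ) ^ 2) * sin_sq_add_cos_sq φ

lemma VyVy_sphH_diagonal (hv₁ : ContDiff ℝ (⊤ : ℕ∞) (Function.uncurry v₁))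
    (hv₂ : ContDiff ℝ (⊤ : ℕ∞) (Function.uncurry v₂)) :
    Vy v₁ v₂ (Vy v₁ v₂ sphH) θ φ θ φ = -nV2 v₁ v₂ θ φ := by
  have h : Vy v₁ v₂ sphH =
    (fun _ _ c d => v₁ c d) * pθy sphH + (fun _ _ c d => v₂ c d) * pφy sphH := rfl
  have h₁ := Smooth4.fun_y hv₁
  have h₂ := Smooth4.fun_y hv₂
  have hθ := smooth4_sphH.pθy
  have hφ := smooth4_sphH.pφy
  rw [h, Vy_add (h₁.mul hθ) (h₂.mul hφ), Vy_mul h₁ hθ, Vy_mul h₂ hφ, pθy_sphH, pφy_sphH]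
  simp [Vy, pθy, pφy, nV2, deriv_comp_const_sub (f := sin), deriv_comp_const_sub (f := cos)]
  linear_combination (-(v₂ θ φ) ^ 2) * sin_sq_add_cos_sq φ

lemma VxVy_sphH_diagonal (hv₁ : ContDiff ℝ (⊤ : ℕ∞) (Function.uncurry v₁))
    (hv₂ : ContDiff ℝ (⊤ : ℕ∞) (Function.uncurry v₂)) :
    Vx v₁ v₂ (Vy v₁ v₂ sphH) θ φ θ φ = nV2 v₁ v₂ θ φ := by
  have h : Vy v₁ v₂ sphH =
    (fun _ _ c d => v₁ c d) * pθy sphH + (fun _ _ c d => v₂ c d) * pφy sphH := rfl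
  have h₁ := Smooth4.fun_y hv₁
  have h₂ := Smooth4.fun_y hv₂
  have hθ := smooth4_sphH.pθy
  have hφ := smooth4_sphH.pφy
  rw [h, Vx_add (h₁.mul hθ) (h₂.mul hφ), Vx_mul h₁ hθ, Vx_mul h₂ hφ, pθy_sphH, pφy_sphH]
  simp [Vx, pθx, pφx, nV2, deriv_comp_sub_const (f := sin), deriv_comp_sub_const (f := cos)]
  linear_combination (v₂ θ φ) ^ 2 * sin_sq_add_cos_sq φ

end Diagonal

section Periodic

variable {v₁ v₂ : ℝ → ℝ → ℝ} {f : F4} {T : ℝ}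

lemma Vx_translate (h₁ : ∀ θ φ, v₁ (θ + T) φ = v₁ θ φ) (h₂ : ∀ θ φ, v₂ (θ + T) φ = v₂ θ φ)
    (hf : ∀ a b c d, f (a + T) b (c + T) d = f a b c d) (a b c d : ℝ) :
    Vx v₁ v₂ f (a + T) b (c + T) d = Vx v₁ v₂ f a b c d := by
  simp only [Vx, pθx, pφx, h₁, h₂, hf]
  rw [← deriv_comp_add_const (f := fun t => f t b (c + T) d)]
  simp only [hf]

lemma Vy_translate (h₁ : ∀ θ φ, v₁ (θ + T) φ = v₁ θ φ) (h₂ : ∀ θ φ, v₂ (θ + T) φ = v₂ θ φ)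
    (hf : ∀ a b c d, f (a + T) b (c + T) d = f a b c d) (a b c d : ℝ) :
    Vy v₁ v₂ f (a + T) b (c + T) d = Vy v₁ v₂ f a b c d := by
  simp only [Vy, pθy, pφy, h₁, h₂, hf]
  rw [← deriv_comp_add_const (f := fun t => f (a + T) b t d)]
  simp only [hf]

lemma sphH_translate (a b c d : ℝ) : sphH (a + T) b (c + T) d = sphH a b c d := by
  simp [sphH]

lemma exists_abs_le_of_periodic {g : ℝ → ℝ → ℝ} (hg : Continuous (Function.uncurry g))
    (hT : 0 < T) (hper : ∀ θ φ, g (θ + T) φ = g θ φ) (r s : ℝ) :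
    ∃ C, ∀ θ, ∀ φ ∈ Set.Icc r s, |g θ φ| ≤ C := by
  obtain ⟨C, hC⟩ := ((isCompact_Icc (a := (0 : ℝ)) (b := T)).prod
    (isCompact_Icc (a := r) (b := s))).exists_bound_of_continuousOn hg.continuousOn
  refine ⟨C, fun θ φ hφ => ?_⟩
  have hp : Function.Periodic (fun θ => g θ φ) T := fun θ => hper θ φ
  obtain ⟨θ₀, hθ₀, h⟩ := hp.exists_mem_Ico₀ hT θ
  have h : g θ φ = g θ₀ φ := h
  rw [h]
  exact hC (θ₀, φ) ⟨Set.Ico_subset_Icc_self hθ₀, hφ⟩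

end Periodic

/-- `V_x V_x V_y V_y P_l(h)` on the diagonal equals
`3 ‖V‖⁴ P_l''(1) + c(θ,φ) P_l'(1)` for a function `c` independent of `l`, and in particular
equals `(3/8)‖V‖⁴ l⁴ + (3/4)‖V‖⁴ l³ + O_V(l²)` uniformly in `(θ,φ)`. -/
theorem VxVxVyVy_on_diagonal
    (v₁ v₂ : ℝ → ℝ → ℝ)
    (hv₁ : ContDiff ℝ (⊤ : ℕ∞) (Function.uncurry v₁)) (hv₂ : ContDiff ℝ (⊤ : ℕ∞) (Function.uncurry v₂))
    (hper₁ : ∀ θ φ : ℝ, v₁ (θ + 2 * π) φ = v₁ θ φ)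
    (hper₂ : ∀ θ φ : ℝ, v₂ (θ + 2 * π) φ = v₂ θ φ) :
    ∃ c : ℝ → ℝ → ℝ,
      (∀ (l : ℕ) (θ φ : ℝ), φ ∈ Set.Ioo 0 π →
        Vx v₁ v₂ (Vx v₁ v₂ (Vy v₁ v₂ (Vy v₁ v₂ (PH l)))) θ φ θ φ =
          3 * (nV2 v₁ v₂ θ φ) ^ 2 * iteratedDeriv 2 (legP l) 1 +
            c θ φ * deriv (legP l) 1) ∧
      ∃ C : ℝ, ∀ (l : ℕ) (θ φ : ℝ), φ ∈ Set.Ioo 0 π →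
        |Vx v₁ v₂ (Vx v₁ v₂ (Vy v₁ v₂ (Vy v₁ v₂ (PH l)))) θ φ θ φ -
            ((3 / 8) * (nV2 v₁ v₂ θ φ) ^ 2 * (l : ℝ) ^ 4 +
              (3 / 4) * (nV2 v₁ v₂ θ φ) ^ 2 * (l : ℝ) ^ 3)| ≤ C * (l : ℝ) ^ 2 := by
  set c : ℝ → ℝ → ℝ := fun θ φ => Vx v₁ v₂ (Vx v₁ v₂ (Vy v₁ v₂ (Vy v₁ v₂ sphH))) θ φ θ φ
  have key (l : ℕ) (θ φ : ℝ) : Vx v₁ v₂ (Vx v₁ v₂ (Vy v₁ v₂ (Vy v₁ v₂ (PH l)))) θ φ θ φ =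
      3 * (nV2 v₁ v₂ θ φ) ^ 2 * (legendrePoly l).derivative.derivative.eval 1 +
        c θ φ * (legendrePoly l).derivative.eval 1 := by
    have hPH : PH l = fun a b c d => (legendrePoly l).eval (sphH a b c d) := by
      funext a b c d
      exact congrFun (legP_eq_eval l) _
    rw [hPH, VxVxVyVy_polynomial_comp hv₁ hv₂ smooth4_sphH _ (Vx_sphH_diagonal v₁ v₂ θ φ)
      (Vy_sphH_diagonal v₁ v₂ θ φ), sphH_diagonal, VxVy_sphH_diagonal θ φ hv₁ hv₂,
      VxVx_sphH_diagonal θ φ hv₁ hv₂, VyVy_sphH_diagonal θ φ hv₁ hv₂]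
    ring
  refine ⟨c, fun l θ φ _ => ?_, ?_⟩
  · rw [key, legP_eq_eval, iteratedDeriv_polynomial_eval, Polynomial.deriv]
    rfl
  · have hc_cont : Continuous (Function.uncurry c) :=
      (((((smooth4_sphH.Vy hv₁ hv₂).Vy hv₁ hv₂).Vx hv₁ hv₂).Vx hv₁ hv₂).continuous).comp
        (f := fun p : ℝ × ℝ => (p.1, p.2, p.1, p.2)) (by fun_prop)
    have hc_per (θ φ : ℝ) : c (θ + 2 * π) φ = c θ φ :=
      Vx_translate hper₁ hper₂ (Vx_translate hper₁ hper₂ (Vy_translate hper₁ hper₂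
        (Vy_translate hper₁ hper₂ sphH_translate))) θ φ θ φ
    have hn_cont : Continuous (Function.uncurry fun θ φ => nV2 v₁ v₂ θ φ ^ 2) :=
      ((((continuous_sin.comp continuous_snd).pow 2).mul (hv₁.continuous.pow 2)).add
        (hv₂.continuous.pow 2)).pow 2
    have hn_per (θ φ : ℝ) : nV2 v₁ v₂ (θ + 2 * π) φ ^ 2 = nV2 v₁ v₂ θ φ ^ 2 := by
      simp only [nV2, hper₁, hper₂]
    obtain ⟨A, hA⟩ := exists_abs_le_of_periodic hc_cont two_pi_pos hc_per 0 π
    obtain ⟨B, hB⟩ := exists_abs_le_of_periodic hn_cont two_pi_pos hn_per 0 π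
    refine ⟨A + 9 / 8 * B, fun l θ φ hφ => ?_⟩
    have hA := hA θ φ (Set.Ioo_subset_Icc_self hφ)
    have hB := hB θ φ (Set.Ioo_subset_Icc_self hφ)
    rw [key, eval_one_derivative_legendrePoly, eval_one_derivative_derivative_legendrePoly]
    generalize nV2 v₁ v₂ θ φ ^ 2 = N at hB ⊢
    generalize c θ φ = k at hA ⊢
    have hl : (l : ℝ) ≤ (l : ℝ) ^ 2 := by exact_mod_cast Nat.le_self_pow two_ne_zero l
    have hl₀ : (0 : ℝ) ≤ l := l.cast_nonneg
    have e : 3 * N * (((l : ℝ) - 1) * l * (l + 1) * (l + 2) / 8) + k * (l * (l + 1) / 2) -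
        (3 / 8 * N * (l : ℝ) ^ 4 + 3 / 4 * N * (l : ℝ) ^ 3) =
        k * (((l : ℝ) ^ 2 + l) / 2) - N * (3 / 8 * (l : ℝ) ^ 2 + 3 / 4 * l) := by ring
    rw [e]
    calc _ ≤ |k| * (((l : ℝ) ^ 2 + l) / 2) + |N| * (3 / 8 * (l : ℝ) ^ 2 + 3 / 4 * l) := by
          refine (abs_sub _ _).trans_eq ?_
          rw [abs_mul, abs_mul, abs_of_nonneg (a := ((l : ℝ) ^ 2 + l) / 2) (by positivity),
            abs_of_nonneg (a := 3 / 8 * (l : ℝ) ^ 2 + 3 / 4 * l) (by positivity)]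
      _ ≤ A * (l : ℝ) ^ 2 + B * (9 / 8 * (l : ℝ) ^ 2) := by
          have hA₀ := (abs_nonneg k).trans hA
          have hB₀ := (abs_nonneg N).trans hB
          gcongr <;> linarith
      _ = _ := by ring
end
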